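/- arXiv:2404.15727 — 2 statements merged into one kernel-verified Lean document; each statement's English description precedes it below -/
import Mathlib

section
/- Let n ≥ 1, 0 ≤ k ≤ n and r ≥ 1. Then dim P_r^− Λ^k(T) = binom(r+k−1, k) · binom(n+r, n−k). -/
open MeasureTheory Matrix

noncomputable section

/-- A differential `k`-form on `ℝⁿ`, recorded via its pointwise evaluation on `k`-tuples of
vectors: `ω x (u 0, …, u (k-1)) : ℝ`. -/
abbrev Form (n k : ℕ) : Type := (Fin n → ℝ) → (Fin k → (Fin n → ℝ)) → ℝ

/-- `ω` is a polynomial differential form: all coefficient functions are polynomial. -/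
def IsPolyForm {n k : ℕ} (ω : Form n k) : Prop :=
  ∀ u : Fin k → (Fin n → ℝ), ∃ p : MvPolynomial (Fin n) ℝ,
    ∀ x, ω x u = MvPolynomial.eval x p

/-- `ω` is a polynomial differential form of degree at most `r`. -/
def IsPolyFormDeg {n k : ℕ} (r : ℕ) (ω : Form n k) : Prop :=
  ∀ u : Fin k → (Fin n → ℝ), ∃ p : MvPolynomial (Fin n) ℝ,
    p.totalDegree ≤ r ∧ ∀ x, ω x u = MvPolynomial.eval x p

/-- `ω` is a continuous differential form. -/
def ContinuousForm {n k : ℕ} (ω : Form n k) : Prop :=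
  ∀ u : Fin k → (Fin n → ℝ), Continuous fun x => ω x u

/-- The standard `k`-simplex `Δᵏ = {x ∈ ℝᵏ : xⱼ ≥ 0, Σⱼ xⱼ ≤ 1}`. -/
def stdSimplexSet (k : ℕ) : Set (Fin k → ℝ) :=
  {x | (∀ j, 0 ≤ x j) ∧ ∑ j, x j ≤ 1}

/-- Integral of the `k`-form `ω` over the affine `k`-simplex with ordered vertices
`p 0, …, p k`:  `∫_{Δᵏ} ω(p₀ + Σⱼ xⱼ (pⱼ − p₀))(p₁ − p₀, …, p_k − p₀) dx`. -/
def simpIntegral {n k : ℕ} (ω : Form n k) (p : Fin (k + 1) → (Fin n → ℝ)) : ℝ :=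
  ∫ x in stdSimplexSet k,
    ω (p 0 + ∑ j : Fin k, x j • (p j.succ - p 0)) (fun j => p j.succ - p 0)

/-- The Whitney form `ω_σ = Σᵢ (−1)ⁱ λ_{σ(i)} dλ_{σ(0)} ∧ … ∧ ω̂ᵢ ∧ … ∧ dλ_{σ(k)}`, where the
wedge of the (constant) differentials `dλⱼ` is evaluated as a determinant. -/
def whitney {n k : ℕ} (lam : Fin (n + 1) → ((Fin n → ℝ) →ᵃ[ℝ] ℝ))
    (σ : Fin (k + 1) → Fin (n + 1)) : Form n k :=
  fun x u => ∑ i : Fin (k + 1), (-1 : ℝ) ^ (i : ℕ) * lam (σ i) x *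
    Matrix.det (Matrix.of fun a b : Fin k => (lam (σ (i.succAbove a))).linear (u b))

/-- `λ^α ω_σ`, the Whitney form scaled by the barycentric monomial `λ^α`. -/
def scaledWhitney {n k : ℕ} (lam : Fin (n + 1) → ((Fin n → ℝ) →ᵃ[ℝ] ℝ))
    (α : Fin (n + 1) → ℕ) (σ : Fin (k + 1) → Fin (n + 1)) : Form n k :=
  fun x u => (∏ i, lam i x ^ α i) * whitney lam σ x u

/-- The space `P_r^- Λ^k(T)`: the span of `p · ω_σ` for `p` a polynomial of degree `≤ r − 1`
and `σ` strictly increasing. -/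
def PrMinus (n k r : ℕ) (lam : Fin (n + 1) → ((Fin n → ℝ) →ᵃ[ℝ] ℝ)) :
    Submodule ℝ (Form n k) :=
  Submodule.span ℝ {η : Form n k | ∃ (p : MvPolynomial (Fin n) ℝ)
    (σ : Fin (k + 1) → Fin (n + 1)), StrictMono σ ∧ p.totalDegree ≤ r - 1 ∧
    η = fun x u => MvPolynomial.eval x p * whitney lam σ x u}

/-- The small `k`-simplex `s_{(α,σ)}`, given by its ordered vertices
`(v_{σ(j)} + Σᵢ αᵢ vᵢ)/r`. -/
def smallSimplex {n k : ℕ} (v : Fin (n + 1) → (Fin n → ℝ)) (r : ℕ)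
    (σ : Fin (k + 1) → Fin (n + 1)) (α : Fin (n + 1) → ℕ) :
    Fin (k + 1) → (Fin n → ℝ) :=
  fun j => (r : ℝ)⁻¹ • (v (σ j) + ∑ i, (α i : ℝ) • v i)

/-- The index set of the minimal set `X_{r,min}^k(T)`: pairs `(σ, α)` with `σ` strictly
increasing, `|α| = r − 1` and `αᵢ = 0` for every `i < σ(0)`. -/
def MinIdx (n k r : ℕ) : Type :=
  {q : (Fin (k + 1) → Fin (n + 1)) × (Fin (n + 1) → ℕ) //
    StrictMono q.1 ∧ (∑ i, q.2 i) = r - 1 ∧ ∀ i, i < q.1 0 → q.2 i = 0}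

/-- The interpolation operator `Π ω = Σᵢ (∫_{sᵢ} ω) ω_{sᵢ}` built from a dual family `ωs`. -/
def lagrangeProj {n k N : ℕ} (s : Fin N → Fin (k + 1) → (Fin n → ℝ))
    (ωs : Fin N → Form n k) (ω : Form n k) : Form n k :=
  fun x u => ∑ i, simpIntegral ω (s i) * ωs i x u

/-- Least squares error functional `Σᵢ (∫_{sᵢ} (η − ω))²`. -/
def lsError {n k M : ℕ} (s : Fin M → Fin (k + 1) → (Fin n → ℝ))
    (ω η : Form n k) : ℝ :=
  ∑ i, (simpIntegral (η - ω) (s i)) ^ 2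

lemma minIdx_equiv (n k r : ℕ) :
    Nonempty (MinIdx n k r ≃ ↥((Finset.univ : Finset (Fin (n + 1))).sigma (fun m =>
      Finset.powersetCard k (Finset.Ioi m) ×ˢ Finset.finsuppAntidiag (Finset.Ici m) (r - 1)))) := by
  classical
  refine ⟨Equiv.ofBijective (fun q => ⟨⟨q.1.1 0, (Finset.univ.image (fun a : Fin k => q.1.1 a.succ),
    Finsupp.equivFunOnFinite.symm q.1.2)⟩, ?_⟩) ⟨?_, ?_⟩⟩
  · obtain ⟨⟨σ, α⟩, hσ, hα, h0⟩ := q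
    simp only [Finset.mem_sigma, Finset.mem_univ, true_and, Finset.mem_product,
      Finset.mem_powersetCard, Finset.mem_finsuppAntidiag]
    refine ⟨⟨?_, ?_⟩, ?_, ?_⟩
    · intro x hx
      simp only [Finset.mem_image, Finset.mem_univ, true_and] at hx
      obtain ⟨a, rfl⟩ := hx
      exact Finset.mem_Ioi.2 (hσ (Fin.succ_pos a))
    · rw [Finset.card_image_of_injective _ (fun a b h => Fin.succ_injective _ (hσ.injective h))]
      simp
    · rw [← hα]
      refine Finset.sum_subset_zero_on_sdiff (Finset.subset_univ _) ?_ (fun _ _ => rfl)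
      intro x hx
      simp at hx
      exact h0 x hx
    · intro i hi
      by_contra h
      simp at hi h
      exact hi (h0 i h)
  · rintro ⟨⟨σ, α⟩, hσ, hα, h0⟩ ⟨⟨τ, β⟩, hτ, hβ, h0'⟩ h
    simp only [Subtype.mk.injEq, Sigma.mk.injEq] at h
    obtain ⟨h1, h2⟩ := h
    have h2 := eq_of_heq h2
    simp only [Prod.mk.injEq, EmbeddingLike.apply_eq_iff_eq] at h2
    obtain ⟨h2, h3⟩ := h2
    have : (fun a : Fin k => σ a.succ) = fun a : Fin k => τ a.succ := by
      apply (StrictMono.range_inj (fun a b h => hσ (Fin.succ_lt_succ_iff.2 h))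
        (fun a b h => hτ (Fin.succ_lt_succ_iff.2 h))).1
      have := congrArg (fun s : Finset (Fin (n+1)) => (s : Set (Fin (n+1)))) h2
      simpa using this
    have h4 : σ = τ := by
      funext a
      refine Fin.cases h1 (fun a => congrFun this a) a
    subst h4 h3
    rfl
  · rintro ⟨⟨m, S, f⟩, h⟩
    have h' := h
    simp only [Finset.mem_sigma, Finset.mem_univ, true_and, Finset.mem_product,
      Finset.mem_powersetCard, Finset.mem_finsuppAntidiag] at h'
    obtain ⟨⟨hS, hc⟩, hs, hsupp⟩ := h'
    refine ⟨⟨(Fin.cons m (S.orderEmbOfFin hc), f), ?_, ?_, ?_⟩, ?_⟩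
    · simp only
      rw [Fin.strictMono_iff_lt_succ]
      intro i
      cases k with
      | zero => exact i.elim0
      | succ k =>
        refine Fin.cases ?_ (fun i => ?_) i
        · simpa using hS (S.orderEmbOfFin_mem hc 0)
        · rw [← Fin.succ_castSucc]
          simp
    · rw [← hs]
      symm
      refine Finset.sum_subset_zero_on_sdiff (Finset.subset_univ _) ?_ (fun _ _ => rfl)
      intro x hx
      by_contra h
      exact (Finset.mem_sdiff.1 hx).2 (hsupp (by simpa using h))
    · intro i hi
      by_contra h
      have := hsupp (x := i) (by simpa using h)
      simp at this hi
      exact absurd hi (not_lt.2 this)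
    · simp only [Fin.cons_zero, Fin.cons_succ]
      congr 3
      · apply Finset.coe_injective
        simp
      · exact Finsupp.equivFunOnFinite.symm_apply_apply f

lemma minIdx_count (n k r : ℕ) (hk : k ≤ n) (hr : 1 ≤ r) :
    ((Finset.univ : Finset (Fin (n + 1))).sigma (fun m =>
      Finset.powersetCard k (Finset.Ioi m) ×ˢ
        Finset.finsuppAntidiag (Finset.Ici m) (r - 1))).card =
      (r + k - 1).choose k * (n + r).choose (n - k) := by
  obtain ⟨s, rfl⟩ : ∃ s, r = s + 1 := ⟨r - 1, by omega⟩
  rw [Finset.card_sigma]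
  simp only [Finset.card_product, Finset.card_powersetCard,
    Finset.card_finsuppAntidiag_nat_eq_choose, Fin.card_Ioi, Fin.card_Ici]
  rw [Fin.sum_univ_eq_sum_range (fun m => (n + 1 - 1 - m).choose k *
    (n + 1 - m + (s + 1 - 1) - 1).choose (s + 1 - 1)) (n + 1)]
  rw [← Finset.sum_range_reflect]
  have h1 : ∀ j ∈ Finset.range (n + 1), (n + 1 - 1 - (n + 1 - 1 - j)).choose k *
      (n + 1 - (n + 1 - 1 - j) + (s + 1 - 1) - 1).choose (s + 1 - 1) =
      (s + k).choose k * (s + j).choose (s + k) := by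
    intro j hj
    have hj := Finset.mem_range.1 hj
    have e1 : n + 1 - 1 - (n + 1 - 1 - j) = j := by omega
    have e2 : n + 1 - (n + 1 - 1 - j) + (s + 1 - 1) - 1 = s + j := by omega
    have e3 : s + 1 - 1 = s := by omega
    rw [e1, e2, e3]
    by_cases hjk : k ≤ j
    · have := Nat.choose_mul (n := s + j) (k := s + k) (s := s) (by omega)
      rw [show s + j - s = j by omega, show s + k - s = k by omega] at this
      have e4 : (s + k).choose k = (s + k).choose s := by
        rw [← Nat.choose_symm_add]
      rw [e4]
      linarith
    · rw [Nat.choose_eq_zero_of_lt (by omega : j < k),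
        Nat.choose_eq_zero_of_lt (by omega : s + j < s + k)]
      simp
  rw [Finset.sum_congr rfl h1, ← Finset.mul_sum]
  rw [show s + 1 + k - 1 = s + k by omega]
  congr 1
  have h2 : ∀ N, ∑ j ∈ Finset.range (N + 1), (s + j).choose (s + k) =
      (s + N + 1).choose (s + k + 1) := by
    intro N
    induction N with
    | zero =>
      rcases Nat.eq_zero_or_pos k with rfl | h
      · simp
      · rw [Nat.choose_eq_zero_of_lt (by omega : s + 0 + 1 < s + k + 1)]
        simp [Nat.choose_eq_zero_of_lt (by omega : s < s + k)]
    | succ N ih =>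
      rw [Finset.sum_range_succ, ih, show s + (N + 1) + 1 = (s + N + 1) + 1 by ring,
        Nat.choose_succ_succ (s + N + 1), add_comm, show s + (N + 1) = s + N + 1 by ring]
  rw [h2, show n + (s + 1) = s + n + 1 by ring, ← Nat.choose_symm (by omega)]
  congr 1
  omega

section bary
variable {n : ℕ} {v : Fin (n + 1) → (Fin n → ℝ)} {lam : Fin (n + 1) → ((Fin n → ℝ) →ᵃ[ℝ] ℝ)}

lemma lam_comb (hlam : ∀ i j, lam i (v j) = if i = j then 1 else 0)
    (y : Fin (n + 1) → ℝ) (hy : ∑ i, y i = 1) (j : Fin (n + 1)) :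
    lam j (∑ i, y i • v i) = y j := by
  rw [← Finset.univ.affineCombination_eq_linear_combination _ _ hy,
    Finset.map_affineCombination _ _ _ hy,
    Finset.univ.affineCombination_eq_linear_combination _ _ hy]
  simp [hlam]

lemma lam_repr (hv : AffineIndependent ℝ v)
    (hlam : ∀ i j, lam i (v j) = if i = j then 1 else 0) (x : Fin n → ℝ) :
    ∑ i, lam i x = 1 ∧ ∑ i, lam i x • v i = x := by
  have htop : affineSpan ℝ (Set.range v) = ⊤ := by
    rw [hv.affineSpan_eq_top_iff_card_eq_finrank_add_one]
    simp
  let b : AffineBasis (Fin (n + 1)) ℝ (Fin n → ℝ) := ⟨v, hv, htop⟩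
  have h1 : ∑ i, b.coord i x • v i = x := b.linear_combination_coord_eq_self x
  have h2 : ∑ i, b.coord i x = 1 := b.sum_coord_apply_eq_one x
  have h3 : ∀ j, lam j x = b.coord j x := by
    intro j
    have := lam_comb hlam _ h2 j
    rwa [h1] at this
  simp only [h3]
  exact ⟨h2, h1⟩

lemma whitney_eq_det {k : ℕ} (σ : Fin (k + 1) → Fin (n + 1)) (x : Fin n → ℝ)
    (u : Fin k → (Fin n → ℝ)) :
    whitney lam σ x u = Matrix.det (Matrix.of fun a : Fin (k + 1) =>
      (Fin.cons (lam (σ a) x) (fun b => (lam (σ a)).linear (u b)) : Fin (k + 1) → ℝ)) := by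
  rw [Matrix.det_succ_column_zero]
  rfl

lemma whitney_sub {k : ℕ} (hlam : ∀ i j, lam i (v j) = if i = j then 1 else 0)
    (σ : Fin (k + 1) → Fin (n + 1)) (ρ : Fin k → Fin (n + 1)) (x : Fin n → ℝ) :
    whitney lam σ x (fun b => v (ρ b) - x) = ∑ i : Fin (k + 1), (-1 : ℝ) ^ (i : ℕ) * lam (σ i) x *
      Matrix.det (Matrix.of fun a b : Fin k => if σ (i.succAbove a) = ρ b then (1 : ℝ) else 0) := by
  have : ∑ i : Fin (k + 1), (-1 : ℝ) ^ (i : ℕ) * lam (σ i) x *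
      Matrix.det (Matrix.of fun a b : Fin k => if σ (i.succAbove a) = ρ b then (1 : ℝ) else 0) =
      Matrix.det (Matrix.of fun a : Fin (k + 1) =>
      (Fin.cons (lam (σ a) x) (fun b => if σ a = ρ b then (1 : ℝ) else 0) : Fin (k + 1) → ℝ)) := by
    rw [Matrix.det_succ_column_zero]
    rfl
  rw [this, whitney_eq_det, ← Matrix.det_transpose]
  conv_rhs => rw [← Matrix.det_transpose]
  refine Matrix.det_eq_of_forall_row_eq_smul_add_const (Fin.cons 0 (fun _ => -1)) 0 (by simp) ?_
  intro i j
  refine Fin.cases ?_ (fun i => ?_) i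
  · simp
  · have h := (lam (σ j)).linearMap_vsub (v (ρ i)) x
    simp only [vsub_eq_sub] at h
    simp only [Matrix.transpose_apply, Matrix.of_apply, Fin.cons_succ, Fin.cons_zero, h, hlam]
    ring

/-- Koszul relation between Whitney forms. -/
lemma whitney_rel {k : ℕ} (τ : Fin (k + 2) → Fin (n + 1)) (x : Fin n → ℝ)
    (u : Fin k → (Fin n → ℝ)) :
    ∑ j : Fin (k + 2), (-1 : ℝ) ^ (j : ℕ) * lam (τ j) x *
      whitney lam (fun a => τ (j.succAbove a)) x u = 0 := by
  have h : Matrix.det (Matrix.of fun a : Fin (k + 2) =>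
      (Fin.cons (lam (τ a) x) (Fin.cons (lam (τ a) x) (fun b => (lam (τ a)).linear (u b)) :
        Fin (k + 1) → ℝ) : Fin (k + 2) → ℝ)) = 0 := by
    apply Matrix.det_zero_of_column_eq (i := 0) (j := 1) (by simp)
    intro a
    rfl
  rw [Matrix.det_succ_column_zero] at h
  rw [← h]
  refine Finset.sum_congr rfl fun j _ => ?_
  rw [whitney_eq_det]
  rfl

/-- Homogeneous coefficient polynomial. -/
def coefPoly {k : ℕ} (ρ : Fin k → Fin (n + 1)) (σ : Fin (k + 1) → Fin (n + 1))
    (α : Fin (n + 1) → ℕ) :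
    MvPolynomial (Fin (n + 1)) ℝ :=
  ∑ i : Fin (k + 1), MvPolynomial.monomial
    (Finsupp.equivFunOnFinite.symm α + Finsupp.single (σ i) 1)
    ((-1 : ℝ) ^ (i : ℕ) *
      Matrix.det (Matrix.of fun a b : Fin k =>
        if σ (i.succAbove a) = ρ b then (1 : ℝ) else 0))

lemma eval_coefPoly {k r : ℕ} (hr : 1 ≤ r)
    (hlam : ∀ i j, lam i (v j) = if i = j then 1 else 0)
    (ρ : Fin k → Fin (n + 1)) (σ : Fin (k + 1) → Fin (n + 1))
    (α : Fin (n + 1) → ℕ) (hα : ∑ i, α i = r - 1) (y : Fin (n + 1) → ℝ) (hy : ∑ i, y i ≠ 0) :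
    MvPolynomial.eval y (coefPoly ρ σ α) = (∑ i, y i) ^ r *
      scaledWhitney lam α σ (∑ i, (y i / ∑ i, y i) • v i)
        (fun b => v (ρ b) - ∑ i, (y i / ∑ i, y i) • v i) := by
  set s := ∑ i, y i with hs
  have h1 : ∑ i, y i / s = 1 := by rw [← Finset.sum_div, ← hs, div_self hy]
  have h2 := lam_comb hlam (fun i => y i / s) h1
  unfold scaledWhitney
  rw [whitney_sub hlam]
  simp only [h2]
  unfold coefPoly
  have h3 : s ^ r = s ^ (∑ i, α i) * s := by
    rw [hα, ← pow_succ, Nat.sub_add_cancel hr]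
  have h4 : ∏ i, (y i / s) ^ α i = (∏ i, y i ^ α i) / s ^ (∑ i, α i) := by
    rw [← Finset.prod_pow_eq_pow_sum, ← Finset.prod_div_distrib]
    simp [div_pow]
  clear_value s
  rw [h3, h4, map_sum, Finset.mul_sum, Finset.mul_sum]
  refine Finset.sum_congr rfl fun i _ => ?_
  rw [MvPolynomial.eval_monomial, Finsupp.prod_add_index' (by simp) (by intros; rw [pow_add]),
    Finsupp.prod_single_index (by simp), Finsupp.prod_fintype _ _ (by simp)]
  simp only [Finsupp.equivFunOnFinite_symm_apply_apply, pow_one]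
  field_simp

open Classical in
lemma coeff_coefPoly {k : ℕ} (σ τ : Fin (k + 1) → Fin (n + 1)) (α β : Fin (n + 1) → ℕ)
    (hσ : StrictMono σ) (hτ : StrictMono τ) (h0' : ∀ i, i < τ 0 → β i = 0) (h : σ 0 ≤ τ 0) :
    MvPolynomial.coeff (Finsupp.equivFunOnFinite.symm α + Finsupp.single (σ 0) 1)
      (coefPoly (fun a => σ a.succ) τ β) = if τ = σ ∧ β = α then 1 else 0 := by
  unfold coefPoly
  simp only [MvPolynomial.coeff_sum, MvPolynomial.coeff_monomial]
  rcases h.lt_or_eq with h | h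
  · rw [if_neg]
    · apply Finset.sum_eq_zero
      intro i _
      rw [if_neg]
      intro he
      have he := DFunLike.congr_fun he (σ 0)
      have h5 : τ 0 ≤ τ i := hτ.monotone (Fin.zero_le i)
      have h6 : τ i ≠ σ 0 := (h.trans_le h5).ne'
      simp [h0' _ h, h6] at he
    · intro he
      exact h.ne' (congrFun he.1 0)
  · rw [Fin.sum_univ_succ, Finset.sum_eq_zero, add_zero]
    · have key : Matrix.det (Matrix.of fun a b : Fin k =>
          if τ (Fin.succAbove 0 a) = σ b.succ then (1 : ℝ) else 0) =
          if τ = σ then 1 else 0 := by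
        split_ifs with hτσ
        · subst hτσ
          rw [← Matrix.det_one (n := Fin k)]
          congr 1
          ext a b
          simp [Matrix.one_apply, hτ.injective.eq_iff]
        · by_contra hne
          apply hτσ
          have hsub : ∀ a : Fin k, ∃ b : Fin k, τ a.succ = σ b.succ := by
            intro a
            by_contra! hcon
            apply hne
            apply Matrix.det_eq_zero_of_row_eq_zero a
            intro b
            simp [hcon b]
          have hst : StrictMono (fun a : Fin k => τ a.succ) :=
            fun a b h => hτ (Fin.succ_lt_succ_iff.2 h)
          have hss : StrictMono (fun a : Fin k => σ a.succ) :=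
            fun a b h => hσ (Fin.succ_lt_succ_iff.2 h)
          have hr : Set.range (fun a : Fin k => τ a.succ) = Set.range (fun a : Fin k => σ a.succ) := by
            apply Set.eq_of_subset_of_ncard_le
            · rintro _ ⟨a, rfl⟩
              obtain ⟨b, hb⟩ := hsub a
              exact ⟨b, hb.symm⟩
            · rw [Set.ncard_range_of_injective hst.injective,
                Set.ncard_range_of_injective hss.injective]
            · exact Set.finite_range _
          have := (hst.range_inj hss).1 hr
          funext a
          exact Fin.cases h.symm (fun a => congrFun this a) a
      rw [key]
      by_cases hτσ : τ = σ
      · subst hτσ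
        simp
      · simp [hτσ]
    · intro i _
      split_ifs
      · cases k with
        | zero => exact i.elim0
        | succ k =>
          rw [Matrix.det_eq_zero_of_row_eq_zero 0, mul_zero]
          intro b
          have : σ 0 ≠ σ b.succ := (hσ (Fin.succ_pos b)).ne
          simp [← h, this]
      · rfl

lemma linInd {k r : ℕ} (hr : 1 ≤ r)
    (hlam : ∀ i j, lam i (v j) = if i = j then 1 else 0) [Fintype (MinIdx n k r)] :
    LinearIndependent ℝ (fun q : MinIdx n k r => scaledWhitney lam q.1.2 q.1.1) := by
  classical
  rw [Fintype.linearIndependent_iff]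
  intro g hg
  have hP : ∀ ρ : Fin k → Fin (n + 1), ∑ q : MinIdx n k r, MvPolynomial.C (g q) * coefPoly ρ q.1.1 q.1.2 = 0 := by
    intro ρ
    apply MvPolynomial.funext_set (fun _ => Set.Ioi 0) (fun _ => Set.Ioi_infinite 0)
    intro y hy
    have hs : ∑ i, y i ≠ 0 :=
      (Finset.sum_pos (fun i _ => hy i trivial) Finset.univ_nonempty).ne'
    rw [map_sum, map_zero]
    simp only [map_mul, MvPolynomial.eval_C, fun q : MinIdx n k r =>
      eval_coefPoly hr hlam ρ q.1.1 q.1.2 q.2.2.1 y hs]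
    have := congrFun (congrFun hg (∑ i, (y i / ∑ i, y i) • v i))
      (fun b => v (ρ b) - ∑ i, (y i / ∑ i, y i) • v i)
    simp only [Finset.sum_apply, Pi.smul_apply, smul_eq_mul, Pi.zero_apply] at this
    rw [← mul_zero ((∑ i, y i) ^ r), ← this, Finset.mul_sum]
    refine Finset.sum_congr rfl fun q _ => by ring
  have main : ∀ m : ℕ, ∀ q : MinIdx n k r, (q.1.1 0 : ℕ) = m → g q = 0 := by
    intro m
    induction m using Nat.strong_induction_on with
    | _ m ih =>
      intro q hq
      have h := congrArg (MvPolynomial.coeff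
        (Finsupp.equivFunOnFinite.symm q.1.2 + Finsupp.single (q.1.1 0) 1))
        (hP (fun a => q.1.1 a.succ))
      rw [MvPolynomial.coeff_sum, Finset.sum_eq_single q] at h
      · simpa [MvPolynomial.coeff_C_mul, coeff_coefPoly q.1.1 q.1.1 q.1.2 q.1.2 q.2.1 q.2.1 q.2.2.2 le_rfl] using h
      · intro p _ hp
        rw [MvPolynomial.coeff_C_mul]
        by_cases hpq : q.1.1 0 ≤ p.1.1 0
        · rw [coeff_coefPoly q.1.1 p.1.1 q.1.2 p.1.2 q.2.1 p.2.1 p.2.2.2 hpq, if_neg, mul_zero]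
          rintro ⟨e1, e2⟩
          exact hp (Subtype.ext (Prod.ext e1 e2))
        · rw [ih (p.1.1 0 : ℕ) (by rw [← hq]; exact not_le.1 hpq) p rfl, zero_mul]
      · simp
  exact fun q => main _ q rfl

lemma scaled_mem {k r : ℕ} (σ : Fin (k + 1) → Fin (n + 1)) (hσ : StrictMono σ)
    (α : Fin (n + 1) → ℕ) (hα : ∑ i, α i = r - 1) :
    scaledWhitney lam α σ ∈ Submodule.span ℝ
      (Set.range (fun q : MinIdx n k r => scaledWhitney lam q.1.2 q.1.1)) := by
  classical
  by_cases h0 : ∀ i, i < σ 0 → α i = 0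
  · exact Submodule.subset_span ⟨⟨(σ, α), hσ, hα, h0⟩, rfl⟩
  push Not at h0
  have hne : (Finset.univ.filter (fun i => i < σ 0 ∧ α i ≠ 0)).Nonempty := by
    obtain ⟨i, hi⟩ := h0
    exact ⟨i, by simpa using hi⟩
  obtain ⟨m, hm, hmin⟩ := Finset.exists_min_image _ id hne
  simp only [Finset.mem_filter, Finset.mem_univ, true_and, id] at hm hmin
  obtain ⟨hmσ, hmα⟩ := hm
  have hlow : ∀ i, i < m → α i = 0 := by
    intro i hi
    by_contra hc
    exact absurd hi (not_lt.2 (hmin i ⟨hi.trans hmσ, hc⟩))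
  let τ : Fin (k + 2) → Fin (n + 1) := Fin.cons m σ
  have hτ : StrictMono τ := by
    rw [Fin.strictMono_iff_lt_succ]
    intro i
    refine Fin.cases ?_ (fun i => ?_) i
    · simpa [τ] using hmσ
    · rw [← Fin.succ_castSucc]
      simpa [τ] using hσ (Fin.castSucc_lt_succ (i := i))
  let α' : Fin (k + 1) → Fin (n + 1) → ℕ := fun j i =>
    (α i - if i = m then 1 else 0) + if i = σ j then 1 else 0
  have hsub : ∀ i, (α i - if i = m then 1 else 0) + (if i = m then 1 else 0) = α i := by
    intro i
    split_ifs with h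
    · subst h; omega
    · simp
  have hexp : scaledWhitney lam α σ = ∑ j : Fin (k + 1), (-1 : ℝ) ^ (j : ℕ) •
      scaledWhitney lam (α' j) (fun a => τ (j.succ.succAbove a)) := by
    funext x u
    have hrel := whitney_rel (lam := lam) τ x u
    rw [Fin.sum_univ_succ] at hrel
    simp only [τ, Fin.cons_zero, Fin.cons_succ, Fin.val_zero, pow_zero, one_mul,
      Fin.succAbove_zero, Fin.val_succ] at hrel
    simp only [Finset.sum_apply, Pi.smul_apply, smul_eq_mul]
    unfold scaledWhitney
    have e1 : ∏ i, lam i x ^ α i = (∏ i, lam i x ^ (α i - if i = m then 1 else 0)) * lam m x := by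
      rw [Finset.prod_congr rfl (fun i _ => congrArg (fun z => lam i x ^ z) (hsub i).symm)]
      simp only [pow_add, Finset.prod_mul_distrib]
      congr 1
      simp [Finset.prod_ite_eq', pow_ite]
    have e2 : ∀ j, ∏ i, lam i x ^ α' j i =
        (∏ i, lam i x ^ (α i - if i = m then 1 else 0)) * lam (σ j) x := by
      intro j
      simp only [α', pow_add, Finset.prod_mul_distrib]
      congr 1
      simp [Finset.prod_ite_eq', pow_ite]
    simp only [e1, e2]
    rw [mul_assoc, eq_neg_of_add_eq_zero_left hrel, ← Finset.sum_neg_distrib, Finset.mul_sum]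
    refine Finset.sum_congr rfl fun j _ => ?_
    simp only [τ]
    ring
  rw [hexp]
  refine Submodule.sum_mem _ fun j _ => Submodule.smul_mem _ _ (Submodule.subset_span ?_)
  refine ⟨⟨(fun a => τ (j.succ.succAbove a), α' j), ?_, ?_, ?_⟩, rfl⟩
  · exact hτ.comp (Fin.strictMono_succAbove _)
  · rw [← hα]
    have e3 : ∑ i, α i = ∑ i, (α i - if i = m then 1 else 0) + 1 := by
      rw [Finset.sum_congr rfl (fun i _ => (hsub i).symm), Finset.sum_add_distrib]
      simp
    rw [e3]
    simp [α', Finset.sum_add_distrib]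
  · intro i hi
    have hi : i < m := by simpa [τ] using hi
    have : i ≠ σ j := ((hi.trans hmσ).trans_le (hσ.monotone (Fin.zero_le j))).ne
    simp [α', hlow i hi, this]

/-- Rewriting a polynomial of degree at most `s` as homogeneous of degree `s` in `λ`. -/
lemma exists_homog (hv : AffineIndependent ℝ v)
    (hlam : ∀ i j, lam i (v j) = if i = j then 1 else 0) (s : ℕ)
    (p : MvPolynomial (Fin n) ℝ) (hp : p.totalDegree ≤ s) :
    ∃ Q : MvPolynomial (Fin (n + 1)) ℝ, Q.IsHomogeneous s ∧
      ∀ x, MvPolynomial.eval x p = MvPolynomial.eval (fun i => lam i x) Q := by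
  refine ⟨∑ d ∈ p.support, MvPolynomial.C (p.coeff d) *
    ((∏ j, (∑ i, MvPolynomial.C (v i j) * MvPolynomial.X i) ^ d j) *
      (∑ i, MvPolynomial.X i) ^ (s - ∑ j, d j)), ?_, ?_⟩
  · apply MvPolynomial.IsHomogeneous.sum
    intro d hd
    apply MvPolynomial.IsHomogeneous.C_mul
    have hds : ∑ j, d j ≤ s := by
      refine le_trans ?_ hp
      have := MvPolynomial.le_totalDegree hd
      rwa [Finsupp.sum_fintype _ _ (by simp)] at this
    have h1 : (∏ j, (∑ i, MvPolynomial.C (v i j) * MvPolynomial.X i :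
        MvPolynomial (Fin (n + 1)) ℝ) ^ d j).IsHomogeneous (∑ j, d j) := by
      apply MvPolynomial.IsHomogeneous.prod
      intro j _
      have := (MvPolynomial.IsHomogeneous.sum Finset.univ
        (fun i => (MvPolynomial.C (v i j) * MvPolynomial.X i : MvPolynomial (Fin (n + 1)) ℝ)) 1
        (fun i _ => MvPolynomial.isHomogeneous_C_mul_X _ _)).pow (d j)
      simpa using this
    have h2 : ((∑ i, MvPolynomial.X i : MvPolynomial (Fin (n + 1)) ℝ) ^
        (s - ∑ j, d j)).IsHomogeneous (s - ∑ j, d j) := by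
      have := (MvPolynomial.IsHomogeneous.sum Finset.univ
        (fun i => (MvPolynomial.X i : MvPolynomial (Fin (n + 1)) ℝ)) 1
        (fun i _ => MvPolynomial.isHomogeneous_X _ _)).pow (s - ∑ j, d j)
      simpa using this
    have := h1.mul h2
    rwa [Nat.add_sub_cancel' hds] at this
  · intro x
    obtain ⟨h1, h2⟩ := lam_repr hv hlam x
    rw [MvPolynomial.eval_eq', map_sum]
    refine Finset.sum_congr rfl fun d _ => ?_
    simp only [map_mul, MvPolynomial.eval_C, map_prod, map_pow, map_sum, MvPolynomial.eval_X, h1,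
      one_pow, mul_one]
    congr 1
    refine Finset.prod_congr rfl fun j _ => ?_
    congr 1
    have := congrFun h2 j
    simp only [Finset.sum_apply, Pi.smul_apply, smul_eq_mul] at this
    rw [← this]
    exact Finset.sum_congr rfl fun i _ => mul_comm _ _

lemma lam_poly (i : Fin (n + 1)) :
    ∃ p : MvPolynomial (Fin n) ℝ, p.totalDegree ≤ 1 ∧ ∀ x, MvPolynomial.eval x p = lam i x := by
  refine ⟨∑ j, MvPolynomial.C ((lam i).linear (Pi.single j 1)) * MvPolynomial.X j +
    MvPolynomial.C (lam i 0), ?_, ?_⟩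
  · refine (MvPolynomial.totalDegree_add _ _).trans (max_le ?_ (by simp))
    refine MvPolynomial.totalDegree_finsetSum_le fun j _ => ?_
    refine (MvPolynomial.totalDegree_mul _ _).trans (by simp)
  · intro x
    have h1 : lam i x = (lam i).linear x + lam i 0 := by
      have := (lam i).linearMap_vsub x 0
      simp only [vsub_eq_sub, sub_zero] at this
      rw [this]; ring
    rw [h1, map_add, MvPolynomial.eval_C, map_sum]
    congr 1
    conv_rhs => rw [LinearMap.pi_apply_eq_sum_univ]
    refine Finset.sum_congr rfl fun j _ => ?_
    simp only [map_mul, MvPolynomial.eval_C, MvPolynomial.eval_X, smul_eq_mul]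
    rw [mul_comm]
    congr 2
    ext a
    simp [Pi.single_apply, eq_comm]

lemma prMinus_eq_span {k r : ℕ} (hv : AffineIndependent ℝ v)
    (hlam : ∀ i j, lam i (v j) = if i = j then 1 else 0) :
    PrMinus n k r lam = Submodule.span ℝ
      (Set.range (fun q : MinIdx n k r => scaledWhitney lam q.1.2 q.1.1)) := by
  apply le_antisymm
  · refine Submodule.span_le.2 ?_
    rintro _ ⟨p, σ, hσ, hp, rfl⟩
    obtain ⟨Q, hQ, hQe⟩ := exists_homog hv hlam _ p hp
    have : (fun x u => MvPolynomial.eval x p * whitney lam σ x u : Form n k) =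
        ∑ d ∈ Q.support, Q.coeff d • scaledWhitney lam (fun i => d i) σ := by
      funext x u
      rw [hQe, MvPolynomial.eval_eq', Finset.sum_mul]
      simp only [Finset.sum_apply, Pi.smul_apply, smul_eq_mul, scaledWhitney]
      exact Finset.sum_congr rfl fun d _ => mul_assoc _ _ _
    rw [SetLike.mem_coe, this]
    refine Submodule.sum_mem _ fun d hd => Submodule.smul_mem _ _ (scaled_mem σ hσ _ ?_)
    have := hQ.degree_eq_sum_deg_support hd
    rw [this]
    symm
    exact Finset.sum_subset (Finset.subset_univ _) (fun i _ hi => by simpa using hi)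
  · refine Submodule.span_le.2 ?_
    rintro _ ⟨⟨⟨σ, α⟩, hσ, hα, h0⟩, rfl⟩
    choose P hP hPe using fun i => lam_poly (lam := lam) i
    refine Submodule.subset_span ⟨∏ i, P i ^ α i, σ, hσ, ?_, ?_⟩
    · simp only at hα
      rw [← hα]
      refine (MvPolynomial.totalDegree_finsetProd _ _).trans (Finset.sum_le_sum fun i _ => ?_)
      refine (MvPolynomial.totalDegree_pow _ _).trans ?_
      simpa using Nat.mul_le_mul_left (α i) (hP i)
    · funext x u
      simp [scaledWhitney, hPe]

end bary

/-- `dim P_r^- Λ^k(T) = binom(r+k−1, k) · binom(n+r, n−k)`. -/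
theorem prMinus_finrank {n k r : ℕ} (hn : 1 ≤ n) (hk : k ≤ n) (hr : 1 ≤ r)
    (v : Fin (n + 1) → (Fin n → ℝ)) (hv : AffineIndependent ℝ v)
    (lam : Fin (n + 1) → ((Fin n → ℝ) →ᵃ[ℝ] ℝ))
    (hlam : ∀ i j, lam i (v j) = if i = j then 1 else 0) :
    Module.finrank ℝ (PrMinus n k r lam) =
      (r + k - 1).choose k * (n + r).choose (n - k) := by
  obtain ⟨e⟩ := minIdx_equiv n k r
  have : Fintype (MinIdx n k r) := Fintype.ofEquiv _ e.symm
  rw [prMinus_eq_span hv hlam, finrank_span_eq_card (linInd hr hlam), Fintype.card_congr e,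
    Fintype.card_coe, minIdx_count n k r hk hr]
end
end

section
/- (Determination by redundant weights.) Let n ≥ 1, 0 ≤ k ≤ n and r ≥ 1. If ω ∈ P_r^− Λ^k(T) satisfies ∫_{s_{(α,σ)}} ω = 0 for every σ ∈ S_k^n and every multi-index α ∈ I(n+1, r−1), then ω = 0. Equivalently, the linear map P_r^− Λ^k(T) → ℝ^{X_r^k(T)}, ω ↦ (∫_s ω)_{s ∈ X_r^k(T)}, is injective. -/
open MeasureTheory Matrix

noncomputable section

section HelperSection
open MvPolynomial

theorem aux_shift {k : ℕ} {M N : Type*} [AddCommGroup M] [Module ℝ M] [AddCommGroup N] [Module ℝ N]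
    (f : M [⋀^Fin k]→ₗ[ℝ] N) (z : M) (hz : ∀ w : Fin k → M, (∃ i, ∃ c : ℝ, w i = c • z) → f w = 0)
    (w : Fin k → M) (c : Fin k → ℝ) : f (w + fun i => c i • z) = f w := by
  have := f.toMultilinearMap.map_add_univ w (fun i => c i • z)
  simp only [AlternatingMap.coe_multilinearMap] at this
  rw [this, Finset.sum_eq_single Finset.univ]
  · simp
  · intro s _ hs
    obtain ⟨i, hi⟩ : ∃ i, i ∉ s := by
      by_contra h
      push Not at h
      exact hs (Finset.eq_univ_iff_forall.2 h)
    exact hz _ ⟨i, c i, by simp [hi]⟩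
  · simp

def liftOne {k : ℕ} {E N : Type*} [AddCommGroup E] [Module ℝ E] [AddCommGroup N] [Module ℝ N]
    (A : E [⋀^Fin k]→ₗ[ℝ] N) : (E × ℝ) →ₗ[ℝ] (E × ℝ) [⋀^Fin k]→ₗ[ℝ] N :=
  (LinearMap.snd ℝ E ℝ).smulRight (A.compLinearMap (LinearMap.fst ℝ E ℝ))

theorem lemX {k : ℕ} {E N : Type*} [AddCommGroup E] [Module ℝ E] [AddCommGroup N] [Module ℝ N]
    (A : E [⋀^Fin k]→ₗ[ℝ] N) (p : Fin (k + 1) → E) :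
    AlternatingMap.alternatizeUncurryFin (liftOne A) (fun j => (p j, (1 : ℝ))) =
      A (fun j => p j.succ - p 0) := by
  set B := AlternatingMap.alternatizeUncurryFin (liftOne A) with hB
  set q : Fin (k + 1) → E × ℝ := fun j => (p j, (1 : ℝ)) with hq
  have h1 : B q = B.curryLeft (q 0) (fun j => q j.succ) := by
    rw [AlternatingMap.curryLeft_apply_apply]
    congr 1
    exact (Fin.cons_self_tail q).symm
  have h2 := aux_shift (B.curryLeft (q 0)) (q 0) (by
    rintro w ⟨i, c, h⟩
    have : w = Function.update w i (c • q 0) := by rw [← h]; simp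
    rw [this, AlternatingMap.map_update_smul, AlternatingMap.curryLeft_apply_apply]
    rw [B.map_eq_zero_of_eq (i := 0) (j := i.succ), smul_zero]
    · simp
    · exact (Fin.succ_ne_zero i).symm) (fun j => q j.succ) (fun _ => -1)
  rw [h1, ← h2, AlternatingMap.curryLeft_apply_apply, hB, AlternatingMap.alternatizeUncurryFin_apply,
    Fin.sum_univ_succ, Finset.sum_eq_zero]
  · simp [liftOne, q]
    congr 1
    ext j
    simp [sub_eq_add_neg]
  · intro i _
    simp [liftOne, q]

theorem face_sum {k : ℕ} {E N : Type*} [AddCommGroup E] [Module ℝ E] [AddCommGroup N] [Module ℝ N]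
    (A : E [⋀^Fin k]→ₗ[ℝ] N) (p : Fin (k + 2) → E) :
    ∑ i : Fin (k + 2), (-1 : ℤ) ^ (i : ℕ) •
      A (fun j => p (i.succAbove j.succ) - p (i.succAbove 0)) = 0 := by
  have h := AlternatingMap.alternatizeUncurryFin_alternatizeUncurryFinLM_comp_of_symmetric
    (f := (LinearMap.snd ℝ E ℝ).smulRight (liftOne A)) (by
      intro x y
      simp [liftOne]
      rw [smul_comm])
  have h' := congrArg (fun B => B (fun j => (p j, (1 : ℝ)))) h
  simp only [AlternatingMap.alternatizeUncurryFin_apply, AlternatingMap.zero_apply] at h'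
  rw [← h']
  refine Finset.sum_congr rfl fun i _ => ?_
  congr 1
  rw [← lemX A (fun j => p (i.succAbove j))]
  simp
  rfl

theorem ext_mono {n k : ℕ} {E N : Type*} [AddCommGroup E] [Module ℝ E] [AddCommGroup N] [Module ℝ N]
    (e : Module.Basis (Fin n) ℝ E) (A : E [⋀^Fin k]→ₗ[ℝ] N)
    (h : ∀ ρ : Fin k → Fin n, StrictMono ρ → A (fun i => e (ρ i)) = 0) : A = 0 := by
  refine e.ext_alternating fun ρ hρ => ?_
  have hs := Tuple.monotone_sort ρ
  have hs' : StrictMono (ρ ∘ Tuple.sort ρ) :=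
    hs.strictMono_of_injective (hρ.comp (Tuple.sort ρ).injective)
  have h1 := h _ hs'
  have h2 := A.map_perm (fun i => e (ρ i)) (Tuple.sort ρ)
  have h3 : (fun i => e (ρ i)) ∘ (Tuple.sort ρ) = fun i => e ((ρ ∘ Tuple.sort ρ) i) := rfl
  rw [h3, h1] at h2
  simp only [AlternatingMap.zero_apply]
  have := (smul_eq_zero_iff_eq _).1 h2.symm
  exact this

theorem hc_pderiv {n : ℕ} (m : ℕ) (l : Fin n) (f : MvPolynomial (Fin n) ℝ) :
    homogeneousComponent m (pderiv l f) = pderiv l (homogeneousComponent (m + 1) f) := by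
  classical
  ext d
  rw [coeff_homogeneousComponent, coeff_pderiv, coeff_pderiv, coeff_homogeneousComponent]
  have : (d + Finsupp.single l 1).degree = d.degree + 1 := by simp
  rw [this]
  by_cases h : d.degree = m
  · simp [h]
  · simp [h]

theorem totalDegree_le_of_hc {n m : ℕ} (f : MvPolynomial (Fin n) ℝ)
    (h : ∀ j, m < j → homogeneousComponent j f = 0) : f.totalDegree ≤ m := by
  by_contra hlt
  push Not at hlt
  rw [totalDegree, Finset.lt_sup_iff] at hlt
  obtain ⟨s, hs, hms⟩ := hlt
  have := h _ hms
  have h2 := congrArg (coeff s) this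
  rw [coeff_homogeneousComponent, if_pos (by rfl), coeff_zero] at h2
  exact (mem_support_iff.1 hs) h2

theorem totalDegree_bind_le {n N : ℕ} (f : MvPolynomial (Fin n) ℝ)
    (a : Fin n → MvPolynomial (Fin N) ℝ) (ha : ∀ i, (a i).totalDegree ≤ 1) :
    (bind₁ a f).totalDegree ≤ f.totalDegree := by
  conv_lhs => rw [f.as_sum, map_sum]
  refine totalDegree_finsetSum_le fun s hs => ?_
  rw [bind₁_monomial]
  refine (totalDegree_mul _ _).trans ?_
  rw [totalDegree_C, zero_add]
  refine (totalDegree_finsetProd _ _).trans ?_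
  refine le_trans (Finset.sum_le_sum (g := fun i => s i) fun i _ => ?_) (le_totalDegree hs)
  refine (totalDegree_pow _ _).trans ?_
  simpa using Nat.mul_le_mul_left (s i) (ha i)

theorem lattice_zero {n : ℕ} (m : ℕ) (q : MvPolynomial (Fin n) ℝ) (hq : q.totalDegree ≤ m)
    (h : ∀ z : Fin n → ℕ, ∑ i, z i ≤ m → eval (fun i => (z i : ℝ)) q = 0) : q = 0 := by
  by_contra h0
  obtain ⟨t, ht, htd⟩ := Finset.exists_mem_eq_sup q.support (support_nonempty.2 h0)
    (fun s => s.sum fun _ e => e)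
  have htd' : q.totalDegree = t.degree := htd
  obtain ⟨s, hs, hne⟩ := combinatorial_nullstellensatz_exists_eval_nonzero q t
    (mem_support_iff.1 ht) htd' (fun i => (Finset.range (t i + 1)).image (fun a : ℕ => (a : ℝ)))
    (fun i => by
      rw [Finset.card_image_of_injective _ Nat.cast_injective]; simp)
  simp only [Finset.mem_image, Finset.mem_range] at hs
  choose z hz hzs using hs
  apply hne
  have : s = fun i => (z i : ℝ) := by ext i; exact (hzs i).symm
  rw [this]
  apply h
  calc ∑ i, z i ≤ ∑ i, t i := Finset.sum_le_sum fun i _ => by have := hz i; omega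
    _ = t.degree := by simp [Finsupp.degree_eq_sum]
    _ ≤ m := htd' ▸ hq

theorem lattice_zero' {n : ℕ} (m : ℕ) (v : Fin (n + 1) → (Fin n → ℝ))
    (e : Module.Basis (Fin n) ℝ (Fin n → ℝ)) (he : ∀ i, e i = v i.succ - v 0)
    (g : MvPolynomial (Fin n) ℝ) (hg : g.totalDegree ≤ m)
    (h : ∀ α : Fin (n + 1) → ℕ, ∑ i, α i = m → eval (∑ i, (α i : ℝ) • v i) g = 0) : g = 0 := by
  set a : Fin n → MvPolynomial (Fin n) ℝ := fun j => C ((m : ℝ) * v 0 j) + ∑ i, C (e i j) * X i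
  have hev : ∀ z, eval z (bind₁ a g) = eval ((m : ℝ) • v 0 + ∑ i, z i • e i) g := by
    intro z
    rw [← coe_aeval_eq_eval, ← coe_aeval_eq_eval]
    simp only [RingHom.coe_coe]
    rw [aeval_bind₁]
    congr 2
    ext j
    simp [a, mul_comm]
  have hz : bind₁ a g = 0 := by
    refine lattice_zero m _ ((totalDegree_bind_le g a fun j => ?_).trans hg) fun z hz => ?_
    · refine (totalDegree_add _ _).trans (max_le (by rw [totalDegree_C]; exact Nat.zero_le _) ?_)
      refine totalDegree_finsetSum_le fun i _ => ?_
      refine (totalDegree_mul _ _).trans ?_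
      simp
    · rw [hev]
      have := h (Fin.cons (m - ∑ i, z i) z) (by rw [Fin.sum_univ_succ]; simp; omega)
      rw [← this]
      congr 2
      rw [Fin.sum_univ_succ]
      simp only [Fin.cons_zero, Fin.cons_succ, he, smul_sub, Finset.sum_sub_distrib]
      rw [Nat.cast_sub hz, sub_smul, Nat.cast_sum, Finset.sum_smul]
      abel
  refine MvPolynomial.funext fun y => ?_
  have h1 := hev (e.repr (y - (m : ℝ) • v 0))
  rw [e.sum_repr, hz] at h1
  simpa using h1.symm

/-- directional derivative -/
def DL (n : ℕ) : (Fin n → ℝ) →ₗ[ℝ] (MvPolynomial (Fin n) ℝ →ₗ[ℝ] MvPolynomial (Fin n) ℝ) :=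
  ∑ l, (LinearMap.proj l).smulRight (pderiv l).toLinearMap

theorem DL_apply {n : ℕ} (z : Fin n → ℝ) (f : MvPolynomial (Fin n) ℝ) :
    DL n z f = ∑ l, z l • pderiv l f := by
  simp [DL, LinearMap.sum_apply]

/-- the derivative of an alternating-map valued polynomial, as a linear map in the direction -/
def DA {n k : ℕ} (H : (Fin n → ℝ) [⋀^Fin k]→ₗ[ℝ] MvPolynomial (Fin n) ℝ) :
    (Fin n → ℝ) →ₗ[ℝ] (Fin n → ℝ) [⋀^Fin k]→ₗ[ℝ] MvPolynomial (Fin n) ℝ where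
  toFun z := (DL n z).compAlternatingMap H
  map_add' x y := by ext; simp
  map_smul' c x := by ext; simp

theorem removeNth_cons {k : ℕ} {E N : Type*} [AddCommGroup E] [Module ℝ E] [AddCommGroup N]
    [Module ℝ N] (f : E [⋀^Fin k]→ₗ[ℝ] N) (b : Fin k) (x : E) (u : Fin k → E) :
    (-1 : ℤ) ^ ((b.succ : Fin (k + 1)) : ℕ) • f (b.succ.removeNth (Fin.cons x u : Fin (k + 1) → E)) =
      - f (Function.update u b x) := by
  obtain _ | k := k
  · exact b.elim0
  have h1 : b.succ.removeNth (Fin.cons x u : Fin (k + 2) → E) = Fin.cons x (b.removeNth u) := by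
    ext j
    refine Fin.cases ?_ (fun j => ?_) j
    · simp [Fin.removeNth]
    · simp [Fin.removeNth]
  have h2 := f.neg_one_pow_smul_map_insertNth b x (b.removeNth u)
  rw [Fin.insertNth_removeNth] at h2
  rw [h1]
  have h3 : f (Fin.cons x (b.removeNth u)) = (-1 : ℤ) ^ (b : ℕ) • f (Function.update u b x) := h2.symm
  rw [h3, smul_smul, ← pow_add]
  have : (-1 : ℤ) ^ ((b.succ : ℕ) + (b : ℕ)) = -1 := by
    rw [Odd.neg_one_pow]
    rw [Fin.val_succ]
    exact ⟨b, by ring⟩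
  rw [this]
  simp

theorem cartan {n k m : ℕ} (H : (Fin n → ℝ) [⋀^Fin k]→ₗ[ℝ] MvPolynomial (Fin n) ℝ)
    (hh : ∀ u, (H u).IsHomogeneous (m + 1))
    (hK : ∀ u a, ∑ l, X l * H (Function.update u a (Pi.single l 1)) = 0)
    (hd : AlternatingMap.alternatizeUncurryFin (DA H) = 0) : H = 0 := by
  ext1 u
  have hDe : ∀ l f, DL n (Pi.single l 1) f = pderiv l f := by
    intro l f
    rw [DL_apply, Finset.sum_eq_single l]
    · simp
    · intro b _ hb; simp [hb]
    · simp
  have hlin : ∀ b : Fin k, ∀ z : Fin n → ℝ,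
      ∑ l, z l • H (Function.update u b (Pi.single l 1)) = H (Function.update u b z) := by
    intro b z
    have := (LinearMap.pi_apply_eq_sum_univ (H.toMultilinearMap.toLinearMap u b) z)
    simp only [MultilinearMap.toLinearMap_apply, AlternatingMap.coe_multilinearMap] at this
    rw [this]
    refine Finset.sum_congr rfl fun l _ => ?_
    congr 3
    ext j
    simp [Pi.single_apply, eq_comm]
  have hb : ∀ b : Fin k, ∑ l, X l * DL n (u b) (H (Function.update u b (Pi.single l 1))) = - H u := by
    intro b
    have h0 := congrArg (DL n (u b)) (hK u b)
    have h1 : ∀ l : Fin n, ∀ f, DL n (u b) (X l * f) = u b l • f + X l * DL n (u b) f := by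
      intro l f
      simp only [DL_apply, Derivation.leibniz, pderiv_X, smul_eq_mul, smul_add,
        Finset.sum_add_distrib, Finset.mul_sum, mul_smul_comm]
      rw [add_comm]
      congr 1
      rw [Finset.sum_eq_single l]
      · simp
      · intro b _ hb; simp [hb.symm]
      · simp
    rw [map_sum, map_zero] at h0
    simp only [h1, Finset.sum_add_distrib] at h0
    rw [hlin, Function.update_eq_self] at h0
    exact eq_neg_of_add_eq_zero_right h0
  have h2 : ∀ l, X l * pderiv l (H u) =
      ∑ b : Fin k, X l * DL n (u b) (H (Function.update u b (Pi.single l 1))) := by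
    intro l
    have h3 := congrArg (fun B => B (Fin.cons (Pi.single l 1) u)) hd
    simp only [AlternatingMap.alternatizeUncurryFin_apply, AlternatingMap.zero_apply,
      Fin.sum_univ_succ, Fin.cons_zero, Fin.cons_succ, removeNth_cons] at h3
    simp [DA, hDe] at h3
    rw [add_neg_eq_zero] at h3
    rw [← Finset.mul_sum, ← h3]
  have h4 := (hh u).sum_X_mul_pderiv
  simp only [h2] at h4
  rw [Finset.sum_comm] at h4
  simp only [hb] at h4
  simp only [Finset.sum_const, Finset.card_univ, Fintype.card_fin, smul_neg] at h4
  have h5 : (m + 1 + k) • H u = 0 := by rw [add_smul, ← h4]; simp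
  rcases smul_eq_zero.1 h5 with h | h
  · omega
  · exact h

theorem isCompact_stdS (k : ℕ) : IsCompact (stdSimplexSet k) := by
  refine Metric.isCompact_of_isClosed_isBounded ?_ ?_
  · have : stdSimplexSet k = (⋂ j, {x | 0 ≤ x j}) ∩ {x | ∑ j, x j ≤ 1} := by
      ext x; simp [stdSimplexSet]
    rw [this]
    refine (isClosed_iInter fun j => ?_).inter ?_
    · exact isClosed_le continuous_const (continuous_apply j)
    · exact isClosed_le (by fun_prop) continuous_const
  · refine (Metric.isBounded_Icc (0 : Fin k → ℝ) 1).subset ?_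
    rintro x ⟨h1, h2⟩
    refine ⟨h1, fun j => ?_⟩
    exact (Finset.single_le_sum (fun i _ => h1 i) (Finset.mem_univ j)).trans h2

theorem integrable_stdS {k : ℕ} (f : (Fin k → ℝ) → ℝ) (hf : Continuous f) :
    IntegrableOn f (stdSimplexSet k) :=
  hf.continuousOn.integrableOn_compact (isCompact_stdS k)

/-- volume of the standard simplex -/
def volS (k : ℕ) : ℝ := ∫ _x in stdSimplexSet k, (1 : ℝ)

theorem volS_pos (k : ℕ) : 0 < volS k := by
  have hfin : volume (stdSimplexSet k) ≠ ⊤ := (isCompact_stdS k).measure_lt_top.ne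
  have hpos : 0 < volume (stdSimplexSet k) := by
    let U : Set (Fin k → ℝ) := Set.univ.pi fun _ => Set.Ioo (0 : ℝ) (1 / (k + 1))
    have hU : IsOpen U := isOpen_set_pi Set.finite_univ fun _ _ => isOpen_Ioo
    have hne : U.Nonempty := by
      refine ⟨fun _ => 1 / (2 * (k + 1)), fun j _ => ⟨by positivity, ?_⟩⟩
      apply one_div_lt_one_div_of_lt
      · positivity
      · have : (0 : ℝ) ≤ k := by positivity
        linarith
    refine (hU.measure_pos volume hne).trans_le (measure_mono ?_)
    intro x hx
    refine ⟨fun j => (hx j trivial).1.le, ?_⟩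
    calc ∑ j, x j ≤ ∑ j : Fin k, (1 / (k + 1) : ℝ) := Finset.sum_le_sum fun j _ => (hx j trivial).2.le
      _ = k / (k + 1) := by simp [div_eq_mul_inv]
      _ ≤ 1 := by rw [div_le_one (by positivity)]; linarith
  unfold volS
  simp only [integral_const, MeasurableSet.univ, measureReal_restrict_apply, Set.univ_inter,
    smul_eq_mul, mul_one]
  exact ENNReal.toReal_pos hpos.ne' hfin

theorem mom_swap {k : ℕ} (i j : Fin k) :
    ∫ x in stdSimplexSet k, x i = ∫ x in stdSimplexSet k, x j := by
  have hmp := volume_measurePreserving_piCongrLeft (fun _ : Fin k => ℝ) (Equiv.swap i j)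
  have h1 := hmp.setIntegral_preimage_emb (MeasurableEquiv.measurableEmbedding _)
    (fun x : Fin k → ℝ => x i) (stdSimplexSet k)
  rw [← h1]
  have hap : ∀ x : Fin k → ℝ, ∀ a, MeasurableEquiv.piCongrLeft (fun _ : Fin k => ℝ) (Equiv.swap i j) x a
      = x (Equiv.swap i j a) := by
    intro x a
    have := MeasurableEquiv.piCongrLeft_apply_apply (β := fun _ : Fin k => ℝ) (Equiv.swap i j) x
      (Equiv.swap i j a)
    rwa [Equiv.swap_apply_self] at this
  have hpre : (MeasurableEquiv.piCongrLeft (fun _ : Fin k => ℝ) (Equiv.swap i j)) ⁻¹' stdSimplexSet k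
      = stdSimplexSet k := by
    ext x
    simp only [Set.mem_preimage, stdSimplexSet, Set.mem_ofPred_eq, hap]
    rw [Equiv.sum_comp (Equiv.swap i j) x]
    constructor
    · rintro ⟨a, b⟩
      exact ⟨fun l => by simpa using a (Equiv.swap i j l), b⟩
    · rintro ⟨a, b⟩
      exact ⟨fun l => a _, b⟩
  rw [hpre]
  simp [hap]

/-- the reflection exchanging the coordinate `x j` and the slack coordinate -/
def reflL {k : ℕ} (j : Fin k) : (Fin k → ℝ) →ₗ[ℝ] (Fin k → ℝ) where
  toFun x := Function.update x j (- ∑ i, x i)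
  map_add' x y := by
    ext i
    by_cases h : i = j
    · subst h; simp [Finset.sum_add_distrib]; ring
    · simp [h]
  map_smul' c x := by
    ext i
    by_cases h : i = j
    · subst h; simp [Finset.mul_sum]
    · simp [h]

theorem sum_update' {k : ℕ} (j : Fin k) (x : Fin k → ℝ) (c : ℝ) :
    ∑ i, Function.update x j c i = c + (∑ i, x i - x j) := by
  rw [Finset.sum_update_of_mem (Finset.mem_univ j), ← Finset.sum_sdiff (Finset.subset_univ {j})]
  simp

theorem reflL_reflL {k : ℕ} (j : Fin k) (x : Fin k → ℝ) : reflL j (reflL j x) = x := by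
  change Function.update (Function.update x j (- ∑ i, x i)) j
    (- ∑ i, Function.update x j (- ∑ i, x i) i) = x
  rw [sum_update']
  simp

theorem mom_slack {k : ℕ} (j : Fin k) :
    ∫ x in stdSimplexSet k, (1 - ∑ i, x i) = ∫ x in stdSimplexSet k, x j := by
  have hdet : |LinearMap.det (reflL j)| = 1 := by
    have h : reflL j ∘ₗ reflL j = LinearMap.id := LinearMap.ext fun x => reflL_reflL j x
    have h2 := congrArg LinearMap.det h
    rw [LinearMap.det_comp, LinearMap.det_id] at h2
    rw [← sq_eq_sq₀ (abs_nonneg _) zero_le_one, sq_abs, one_pow, sq, h2]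
  have hne : LinearMap.det (reflL j) ≠ 0 := by
    intro h; rw [h] at hdet; simp at hdet
  let L : (Fin k → ℝ) ≃ₗ[ℝ] (Fin k → ℝ) :=
    LinearEquiv.ofInvolutive (reflL j) (reflL_reflL j)
  let φ : (Fin k → ℝ) ≃ₜ (Fin k → ℝ) :=
    L.toContinuousLinearEquiv.toHomeomorph.trans (Homeomorph.addLeft (Pi.single j (1 : ℝ)))
  have hφ : ∀ x, φ x = Pi.single j 1 + reflL j x := fun x => rfl
  have hL : MeasurePreserving (reflL j) volume volume := by
    refine ⟨(LinearMap.continuous_of_finiteDimensional _).measurable, ?_⟩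
    rw [Measure.map_linearMap_addHaar_eq_smul_addHaar volume hne, abs_inv, hdet]
    simp
  have hmp : MeasurePreserving φ volume volume := by
    have := (measurePreserving_add_left (volume : Measure (Fin k → ℝ)) (Pi.single j (1 : ℝ))).comp hL
    exact this
  have h1 := hmp.setIntegral_preimage_emb φ.measurableEmbedding
    (fun x : Fin k → ℝ => x j) (stdSimplexSet k)
  have hj : ∀ x, φ x j = 1 - ∑ i, x i := by
    intro x; rw [hφ]; simp [reflL]; ring
  have hi : ∀ x i, i ≠ j → φ x i = x i := by
    intro x i h; rw [hφ]; simp [reflL, h]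
  have hs : ∀ x, ∑ i, φ x i = 1 - x j := by
    intro x
    have : φ x = Function.update x j (1 - ∑ i, x i) := by
      ext i
      by_cases h : i = j
      · subst h; simp [hj]
      · simp [h, hi x i h]
    rw [this, sum_update']
    ring
  have hpre : φ ⁻¹' stdSimplexSet k = stdSimplexSet k := by
    ext x
    simp only [Set.mem_preimage, stdSimplexSet, Set.mem_ofPred_eq, hs]
    constructor
    · rintro ⟨a, b⟩
      refine ⟨fun i => ?_, ?_⟩
      · by_cases h : i = j
        · subst h; linarith
        · rw [← hi x i h]; exact a i
      · have := a j; rw [hj] at this; linarith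
    · rintro ⟨a, b⟩
      refine ⟨fun i => ?_, ?_⟩
      · by_cases h : i = j
        · subst h; rw [hj]; linarith
        · rw [hi x i h]; exact a i
      · linarith [a j]
  rw [← h1, hpre]
  simp [hj]

theorem mom {k : ℕ} (j : Fin k) : ((k : ℝ) + 1) * ∫ x in stdSimplexSet k, x j = volS k := by
  have h1 := mom_slack j
  rw [integral_sub (integrable_stdS _ continuous_const) (integrable_stdS _ (by fun_prop)),
    integral_finsetSum _ (fun i _ => integrable_stdS _ (by fun_prop))] at h1
  simp only [fun i => mom_swap i j] at h1
  simp only [Finset.sum_const, Finset.card_univ, Fintype.card_fin, nsmul_eq_mul] at h1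
  unfold volS
  linarith

/-- the affine parametrization -/
def par {n k : ℕ} (p : Fin (k + 1) → (Fin n → ℝ)) (x : Fin k → ℝ) : Fin n → ℝ :=
  p 0 + ∑ j : Fin k, x j • (p j.succ - p 0)

theorem par_cont {n k : ℕ} (p : Fin (k + 1) → (Fin n → ℝ)) : Continuous (par p) := by
  unfold par; fun_prop

theorem int_par {n k : ℕ} (p : Fin (k + 1) → (Fin n → ℝ)) (l : Fin n) :
    ∫ x in stdSimplexSet k, par p x l = (volS k / (k + 1)) * ∑ j, p j l := by
  have h1 : ∀ x : Fin k → ℝ, par p x l = p 0 l * 1 + ∑ j : Fin k, (p j.succ l - p 0 l) * x j := by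
    intro x; simp [par, mul_comm]
  simp only [h1]
  rw [integral_add (integrable_stdS _ (by fun_prop)) (integrable_stdS _ (by fun_prop)),
    integral_finsetSum _ (fun i _ => integrable_stdS _ (by fun_prop))]
  simp only [integral_const_mul]
  have hk : (k : ℝ) + 1 ≠ 0 := by positivity
  have h2 : ∀ j : Fin k, ∫ x in stdSimplexSet k, x j = volS k / (k + 1) := fun j => by
    rw [eq_div_iff hk, mul_comm]; exact mom j
  simp only [h2]
  change p 0 l * volS k + _ = _
  rw [Fin.sum_univ_succ, ← Finset.sum_mul, Finset.sum_sub_distrib]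
  simp only [Finset.sum_const, Finset.card_univ, Fintype.card_fin, nsmul_eq_mul]
  field_simp
  ring

theorem hc_mul_X {n : ℕ} (j : ℕ) (f : MvPolynomial (Fin n) ℝ) (l : Fin n) :
    homogeneousComponent (j + 1) (f * X l) = homogeneousComponent j f * X l := by
  classical
  ext d
  rw [coeff_homogeneousComponent, coeff_mul_X', coeff_mul_X', coeff_homogeneousComponent]
  by_cases h : l ∈ d.support
  · have h1 : d = (d - Finsupp.single l 1) + Finsupp.single l 1 := by
      rw [tsub_add_cancel_of_le]
      rw [Finsupp.single_le_iff]
      have := Finsupp.mem_support_iff.1 h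
      omega
    have h2 : d.degree = (d - Finsupp.single l 1).degree + 1 := by
      conv_lhs => rw [h1]
      simp
    rw [h2]
    simp [h]
  · simp [h]

theorem hc_zero_mul_X {n : ℕ} (f : MvPolynomial (Fin n) ℝ) (l : Fin n) :
    homogeneousComponent 0 (f * X l) = 0 := by
  classical
  rw [homogeneousComponent_zero, coeff_mul_X']; simp

theorem hc_DL {n : ℕ} (j : ℕ) (z : Fin n → ℝ) (f : MvPolynomial (Fin n) ℝ) :
    homogeneousComponent j (DL n z f) = DL n z (homogeneousComponent (j + 1) f) := by
  simp [DL_apply, hc_pderiv]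

theorem cont_eval {n k : ℕ} (b : (Fin k → ℝ) → (Fin n → ℝ)) (hb : Continuous b) (y : Fin n → ℝ)
    (f : MvPolynomial (Fin n) ℝ) : Continuous fun x => eval (y + b x) f :=
  (MvPolynomial.continuous_eval f).comp (by fun_prop)

theorem avg_mono {n k : ℕ} (b : (Fin k → ℝ) → (Fin n → ℝ)) (hb : Continuous b)
    (s : Fin n →₀ ℕ) (a : ℝ) :
    ∃ d, (monomial s a).IsHomogeneous d ∧ ∀ w : (Fin k → ℝ) → ℝ, Continuous w →
      ∃ rem : MvPolynomial (Fin n) ℝ,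
      (∀ y, ∫ x in stdSimplexSet k, w x * eval (y + b x) (monomial s a) =
        eval y ((∫ x in stdSimplexSet k, w x) • (monomial s a) +
          ∑ l, (∫ x in stdSimplexSet k, w x * b x l) • pderiv l (monomial s a) + rem)) ∧
      ∀ j, d ≤ j + 1 → homogeneousComponent j rem = 0 := by
  refine induction_on_monomial (motive := fun p => ∃ d, p.IsHomogeneous d ∧
      ∀ w : (Fin k → ℝ) → ℝ, Continuous w →
      ∃ rem : MvPolynomial (Fin n) ℝ,
      (∀ y, ∫ x in stdSimplexSet k, w x * eval (y + b x) p =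
        eval y ((∫ x in stdSimplexSet k, w x) • p +
          ∑ l, (∫ x in stdSimplexSet k, w x * b x l) • pderiv l p + rem)) ∧
      ∀ j, d ≤ j + 1 → homogeneousComponent j rem = 0) ?_ ?_ s a
  · intro a
    refine ⟨0, isHomogeneous_C _ a, fun w hw => ⟨0, fun y => ?_, by simp⟩⟩
    simp [integral_mul_const]
  · rintro p i ⟨d, hd, h⟩
    refine ⟨d + 1, hd.mul (isHomogeneous_X _ i), fun w hw => ?_⟩
    have hwb : Continuous fun x => w x * b x i := by fun_prop
    obtain ⟨r1, h1, h1'⟩ := h w hw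
    obtain ⟨r2, h2, h2'⟩ := h _ hwb
    refine ⟨r1 * X i + ∑ l, (∫ x in stdSimplexSet k, w x * b x i * b x l) • pderiv l p + r2,
      fun y => ?_, fun j hj => ?_⟩
    · have hsplit : ∀ x, w x * eval (y + b x) (p * X i) =
          y i * (w x * eval (y + b x) p) + (w x * b x i) * eval (y + b x) p := by
        intro x; simp; ring
      simp only [hsplit]
      have hce := cont_eval b hb y p
      rw [integral_add (integrable_stdS _ (by fun_prop)) (integrable_stdS _ (by fun_prop)),
        integral_const_mul, h1, h2]
      have hX : ∀ l, pderiv l (p * X i) = pderiv l p * X i + if l = i then p else 0 := by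
        intro l
        rw [Derivation.leibniz, pderiv_X]
        by_cases hl : l = i
        · subst hl; simp; ring
        · simp [hl, Ne.symm hl]; ring
      simp only [hX, smul_add, Finset.sum_add_distrib]
      have hite : ∑ l, (∫ x in stdSimplexSet k, w x * b x l) • (if l = i then p else 0) =
          (∫ x in stdSimplexSet k, w x * b x i) • p := by
        simp
      rw [hite]
      simp only [map_add, map_sum, smul_eval, map_mul, eval_X]
      have hs : ∑ l, (∫ x in stdSimplexSet k, w x * b x l) * (eval y (pderiv l p) * y i) =
          y i * ∑ l, (∫ x in stdSimplexSet k, w x * b x l) * eval y (pderiv l p) := by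
        rw [Finset.mul_sum]; exact Finset.sum_congr rfl fun l _ => by ring
      rw [hs]
      ring
    · rw [map_add, map_add, h2' j (by omega), map_sum, Finset.sum_eq_zero, add_zero, add_zero]
      · obtain _ | j := j
        · exact hc_zero_mul_X _ _
        · rw [hc_mul_X, h1' j (by omega), zero_mul]
      · intro l _
        rw [map_smul, hc_pderiv, homogeneousComponent_eq_zero, map_zero, smul_zero]
        have := hd.totalDegree_le
        omega

theorem avg {n k : ℕ} (p : Fin (k + 1) → (Fin n → ℝ)) (f : MvPolynomial (Fin n) ℝ) (d : ℕ)
    (hf : f.totalDegree ≤ d) :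
    ∃ rem : MvPolynomial (Fin n) ℝ,
      (∀ y, ∫ x in stdSimplexSet k, eval (y + par p x) f =
        eval y (volS k • f + (volS k / (k + 1)) • DL n (∑ j, p j) f + rem)) ∧
      ∀ j, d ≤ j + 1 → homogeneousComponent j rem = 0 := by
  have h : ∀ s ∈ f.support, ∃ rem : MvPolynomial (Fin n) ℝ,
      (∀ y, ∫ x in stdSimplexSet k, eval (y + par p x) (monomial s (coeff s f)) =
        eval y (volS k • monomial s (coeff s f) +
          (volS k / (k + 1)) • DL n (∑ j, p j) (monomial s (coeff s f)) + rem)) ∧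
      ∀ j, d ≤ j + 1 → homogeneousComponent j rem = 0 := by
    intro s hs
    obtain ⟨e, he, h⟩ := avg_mono (par p) (par_cont p) s (coeff s f)
    obtain ⟨rem, h1, h2⟩ := h (fun _ => 1) continuous_const
    refine ⟨rem, fun y => ?_, fun j hj => h2 j ?_⟩
    · have := h1 y
      simp only [one_mul, int_par] at this
      rw [this]
      congr 3
      rw [DL_apply, Finset.smul_sum]
      refine Finset.sum_congr rfl fun l _ => ?_
      rw [smul_smul, Finset.sum_apply]
    · refine le_trans ?_ hj
      refine le_trans ?_ hf
      have h3 := he.totalDegree (by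
        rw [Ne, monomial_eq_zero]; exact mem_support_iff.1 hs)
      rw [← h3, totalDegree_monomial _ (mem_support_iff.1 hs)]
      exact le_totalDegree hs
  choose! rem hr1 hr2 using h
  refine ⟨∑ s ∈ f.support, rem s, fun y => ?_, fun j hj => ?_⟩
  · have hsum : ∀ z, eval z f = ∑ s ∈ f.support, eval z (monomial s (coeff s f)) := by
      intro z
      conv_lhs => rw [f.as_sum, map_sum]
    simp only [hsum]
    rw [integral_finsetSum _ (fun s _ => integrable_stdS _ (cont_eval _ (par_cont p) y _)),
      Finset.sum_congr rfl (fun s hs => hr1 s hs y), ← map_sum, Finset.sum_add_distrib,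
      Finset.sum_add_distrib, ← Finset.smul_sum, ← Finset.smul_sum, ← map_sum, ← f.as_sum]
  · rw [map_sum]
    exact Finset.sum_eq_zero fun s hs => hr2 s hs j hj

/-- linear part of a barycentric coordinate as polynomial -/
def linP {n : ℕ} (L : (Fin n → ℝ) →ₗ[ℝ] ℝ) : MvPolynomial (Fin n) ℝ :=
  ∑ l, L (Pi.single l 1) • X l

theorem eval_linP {n : ℕ} (L : (Fin n → ℝ) →ₗ[ℝ] ℝ) (x : Fin n → ℝ) : eval x (linP L) = L x := by
  rw [linP, map_sum, LinearMap.pi_apply_eq_sum_univ L x]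
  refine Finset.sum_congr rfl fun l _ => ?_
  rw [smul_eval, eval_X, smul_eq_mul, mul_comm]
  congr 2
  ext j
  simp [Pi.single_apply, eq_comm]

/-- constant alternating form of dets -/
def detA {n k : ℕ} (L : Fin k → ((Fin n → ℝ) →ₗ[ℝ] ℝ)) : (Fin n → ℝ) [⋀^Fin k]→ₗ[ℝ] ℝ :=
  (Matrix.detRowAlternating (n := Fin k) (R := ℝ)).compLinearMap (LinearMap.pi L)

theorem detA_apply {n k : ℕ} (L : Fin k → ((Fin n → ℝ) →ₗ[ℝ] ℝ)) (u : Fin k → (Fin n → ℝ)) :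
    detA L u = Matrix.det (Matrix.of fun a b : Fin k => L a (u b)) := by
  rw [← Matrix.det_transpose]
  rfl

theorem altsum_apply {n k : ℕ} {ι N : Type*} [AddCommGroup N] [Module ℝ N] (s : Finset ι)
    (f : ι → (Fin n → ℝ) [⋀^Fin k]→ₗ[ℝ] N) (u : Fin k → (Fin n → ℝ)) :
    (∑ i ∈ s, f i) u = ∑ i ∈ s, f i u := by
  classical
  induction s using Finset.induction_on with
  | empty => simp
  | insert a s ha ih => rw [Finset.sum_insert ha, Finset.sum_insert ha, AlternatingMap.add_apply, ih]

/-- The structural property of forms in `PrMinus`. -/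
def HasRep {n k : ℕ} (m : ℕ) (ω : Form n k) : Prop :=
  ∃ W : (Fin n → ℝ) [⋀^Fin k]→ₗ[ℝ] MvPolynomial (Fin n) ℝ,
    (∀ x u, ω x u = eval x (W u)) ∧ (∀ u, (W u).totalDegree ≤ m + 1) ∧
    ∀ u a, ∑ l, X l * homogeneousComponent (m + 1) (W (Function.update u a (Pi.single l 1))) = 0

theorem rep_gen {n k m : ℕ} (lam : Fin (n + 1) → ((Fin n → ℝ) →ᵃ[ℝ] ℝ))
    (p : MvPolynomial (Fin n) ℝ) (hp : p.totalDegree ≤ m) (σ : Fin (k + 1) → Fin (n + 1)) :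
    HasRep m (fun x u => MvPolynomial.eval x p * whitney lam σ x u) := by
  let A : Fin (k + 1) → (Fin n → ℝ) [⋀^Fin k]→ₗ[ℝ] ℝ := fun i =>
    detA fun a => (lam (σ (i.succAbove a))).linear
  let q : Fin (k + 1) → MvPolynomial (Fin n) ℝ := fun i =>
    p * (linP (lam (σ i)).linear + C (lam (σ i) 0))
  let W : (Fin n → ℝ) [⋀^Fin k]→ₗ[ℝ] MvPolynomial (Fin n) ℝ :=
    ∑ i : Fin (k + 1), ((-1 : ℝ) ^ (i : ℕ)) • (LinearMap.toSpanSingleton ℝ _ (q i)).compAlternatingMap (A i)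
  have hW : ∀ u, W u = ∑ i : Fin (k + 1), ((-1 : ℝ) ^ (i : ℕ)) • A i u • q i := by
    intro u; simp [W, altsum_apply]
  have hq : ∀ i, (q i).totalDegree ≤ m + 1 := by
    intro i
    refine (totalDegree_mul _ _).trans (add_le_add hp ?_)
    refine (totalDegree_add _ _).trans (max_le ?_ (by rw [totalDegree_C]; exact Nat.zero_le _))
    refine totalDegree_finsetSum_le fun l _ => (totalDegree_smul_le _ _).trans (by simp)
  have hhq : ∀ i, homogeneousComponent (m + 1) (q i) =
      homogeneousComponent m p * linP (lam (σ i)).linear := by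
    intro i
    simp only [q, mul_add, map_add]
    rw [mul_comm p (C _), homogeneousComponent_C_mul, homogeneousComponent_eq_zero (m + 1) p (by omega)]
    simp only [linP, Finset.mul_sum, map_sum, mul_smul_comm, map_smul, hc_mul_X, mul_zero, add_zero]
  refine ⟨W, fun x u => ?_, fun u => ?_, fun u a => ?_⟩
  · simp only [whitney]
    rw [hW, map_sum, Finset.mul_sum]
    refine Finset.sum_congr rfl fun i _ => ?_
    have hl : lam (σ i) x = (lam (σ i)).linear x + lam (σ i) 0 := by
      conv_lhs => rw [(lam (σ i)).decomp]
      simp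
    simp only [smul_eval, q, map_mul, map_add, eval_linP, eval_C, A, detA_apply, hl]
    ring
  · rw [hW]
    exact totalDegree_finsetSum_le fun i _ =>
      (totalDegree_smul_le _ _).trans ((totalDegree_smul_le _ _).trans (hq i))
  · refine MvPolynomial.funext fun x => ?_
    have hlin : ∀ i, ∑ l, x l * A i (Function.update u a (Pi.single l 1)) =
        A i (Function.update u a x) := by
      intro i
      have := (LinearMap.pi_apply_eq_sum_univ ((A i).toMultilinearMap.toLinearMap u a) x)
      simp only [MultilinearMap.toLinearMap_apply, AlternatingMap.coe_multilinearMap] at this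
      rw [this]
      refine Finset.sum_congr rfl fun l _ => ?_
      rw [smul_eq_mul]
      congr 3
      ext j
      simp [Pi.single_apply, eq_comm]
    have hdet : ∑ i : Fin (k + 1), (-1 : ℝ) ^ (i : ℕ) * (lam (σ i)).linear x *
        A i (Function.update u a x) = 0 := by
      let M : Matrix (Fin (k + 1)) (Fin (k + 1)) ℝ := Matrix.of fun i j =>
        (lam (σ i)).linear ((Fin.cons x (Function.update u a x) : Fin (k + 1) → (Fin n → ℝ)) j)
      have h0 : M.det = 0 := by
        refine Matrix.det_zero_of_column_eq (i := 0) (j := a.succ) (Fin.succ_ne_zero a).symm ?_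
        intro i
        simp only [M, Matrix.of_apply, Fin.cons_zero, Fin.cons_succ, Function.update_self]
      rw [Matrix.det_succ_column_zero] at h0
      rw [← h0]
      refine Finset.sum_congr rfl fun i _ => ?_
      simp only [A, detA_apply]
      rfl
    simp only [hW, map_sum, map_smul, hhq, Finset.mul_sum, map_mul, smul_eval, eval_X, eval_linP,
      map_zero]
    rw [Finset.sum_comm]
    have hi : ∀ i : Fin (k + 1), ∑ l, x l * ((-1 : ℝ) ^ (i : ℕ) *
        (A i (Function.update u a (Pi.single l 1)) *
          (eval x (homogeneousComponent m p) * (lam (σ i)).linear x))) =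
        eval x (homogeneousComponent m p) * ((-1 : ℝ) ^ (i : ℕ) * (lam (σ i)).linear x *
        A i (Function.update u a x)) := by
      intro i
      rw [← hlin, Finset.mul_sum, Finset.mul_sum]
      exact Finset.sum_congr rfl fun l _ => by ring
    rw [Finset.sum_congr rfl fun i _ => hi i, ← Finset.mul_sum, hdet, mul_zero]

theorem rep_of_mem {n k m : ℕ} (lam : Fin (n + 1) → ((Fin n → ℝ) →ᵃ[ℝ] ℝ)) (ω : Form n k)
    (hω : ω ∈ PrMinus n k (m + 1) lam) : HasRep m ω := by
  refine Submodule.span_induction ?_ ?_ ?_ ?_ hω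
  · rintro _ ⟨p, σ, -, hp, rfl⟩
    exact rep_gen lam p hp σ
  · exact ⟨0, by simp, by simp, by simp⟩
  · rintro ω₁ ω₂ - - ⟨W₁, h1, h2, h3⟩ ⟨W₂, h1', h2', h3'⟩
    refine ⟨W₁ + W₂, fun x u => by simp [h1, h1'], fun u => ?_, fun u a => ?_⟩
    · exact (totalDegree_add _ _).trans (max_le (h2 u) (h2' u))
    · simp [mul_add, Finset.sum_add_distrib, h3, h3']
  · rintro c ω₁ - ⟨W₁, h1, h2, h3⟩
    refine ⟨c • W₁, fun x u => by simp [h1], fun u => ?_, fun u a => ?_⟩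
    · exact (totalDegree_smul_le _ _).trans (h2 u)
    · simp [← Finset.smul_sum, h3]

theorem step_d {n k m : ℕ} (v : Fin (n + 1) → (Fin n → ℝ))
    (e : Module.Basis (Fin n) ℝ (Fin n → ℝ)) (he : ∀ i, e i = v i.succ - v 0)
    (W : (Fin n → ℝ) [⋀^Fin k]→ₗ[ℝ] MvPolynomial (Fin n) ℝ)
    (hdeg : ∀ u, (W u).totalDegree ≤ m + 1)
    (hint : ∀ σ : Fin (k + 1) → Fin (n + 1), StrictMono σ →
      ∀ α : Fin (n + 1) → ℕ, (∑ i, α i) = m →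
        ∫ x in stdSimplexSet k, eval (∑ i, (α i : ℝ) • v i + par (fun j => v (σ j)) x)
          (W fun j => v (σ j.succ) - v (σ 0)) = 0)
    (τ : Fin (k + 2) → Fin (n + 1)) (hτ : StrictMono τ) :
    AlternatingMap.alternatizeUncurryFin
      (DA ((homogeneousComponent (m + 1)).compAlternatingMap W))
      (fun a => v (τ a.succ) - v (τ 0)) = 0 := by
  set u : Fin (k + 2) → Fin k → (Fin n → ℝ) := fun i j =>
    v (τ (i.succAbove j.succ)) - v (τ (i.succAbove 0)) with hu
  set z : Fin (k + 2) → (Fin n → ℝ) := fun i => ∑ j, v (τ (i.succAbove j)) with hz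
  have key := fun i : Fin (k + 2) =>
    avg (fun j => v (τ (i.succAbove j))) (W (u i)) (m + 1) (hdeg _)
  choose rem hr1 hr2 using key
  set c : ℝ := volS k / (k + 1) with hc
  have hc0 : c ≠ 0 := (div_pos (volS_pos k) (by positivity)).ne'
  set G : MvPolynomial (Fin n) ℝ := ∑ i : Fin (k + 2), (-1 : ℤ) ^ (i : ℕ) •
    (volS k • W (u i) + c • DL n (z i) (W (u i)) + rem i) with hG
  have hface : ∀ B : (Fin n → ℝ) [⋀^Fin k]→ₗ[ℝ] MvPolynomial (Fin n) ℝ,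
      ∑ i : Fin (k + 2), (-1 : ℤ) ^ (i : ℕ) • B (u i) = 0 := fun B =>
    face_sum B (fun j => v (τ j))
  have hcG : ∀ j, m ≤ j → homogeneousComponent j G = c • ∑ i : Fin (k + 2), (-1 : ℤ) ^ (i : ℕ) •
      DL n (z i) (homogeneousComponent (j + 1) (W (u i))) := by
    intro j hj
    have h1 := hface ((homogeneousComponent j).compAlternatingMap W)
    simp only [LinearMap.compAlternatingMap_apply] at h1
    rw [hG, map_sum]
    simp only [map_zsmul, map_add, map_smul, hr2 _ j (by omega), add_zero, smul_add,
      Finset.sum_add_distrib, hc_DL, smul_comm _ (volS k), smul_comm _ c, ← Finset.smul_sum, h1]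
    simp
  have hG0 : G = 0 := by
    refine lattice_zero' m v e he G ?_ ?_
    · refine totalDegree_le_of_hc G fun j hj => ?_
      rw [hcG j hj.le, Finset.sum_eq_zero, smul_zero]
      intro i _
      rw [homogeneousComponent_eq_zero _ _ (by have := hdeg (u i); omega), map_zero, smul_zero]
    · intro α hα
      rw [hG, map_sum]
      refine Finset.sum_eq_zero fun i _ => ?_
      rw [map_zsmul, ← hr1, hint (fun j => τ (i.succAbove j))
        (hτ.comp (Fin.strictMono_succAbove i)) α hα, smul_zero]
  have h2 := hcG m le_rfl
  rw [hG0, map_zero] at h2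
  have h3 := (smul_eq_zero.1 h2.symm).resolve_left hc0
  set H := (homogeneousComponent (m + 1)).compAlternatingMap W with hH
  have h3' : ∑ i : Fin (k + 2), (-1 : ℤ) ^ (i : ℕ) • DL n (z i) (H (u i)) = 0 := h3
  have hz' : ∀ i, z i = (∑ j, v (τ j) - v (τ 0)) - (v (τ i) - v (τ 0)) := by
    intro i
    rw [Fin.sum_univ_succAbove _ i]
    simp only [hz]
    abel
  have h4 := hface ((DL n (∑ j, v (τ j) - v (τ 0))).compAlternatingMap H)
  simp only [LinearMap.compAlternatingMap_apply] at h4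
  simp only [hz', map_sub (DL n) (∑ j, v (τ j) - v (τ 0)), LinearMap.sub_apply, smul_sub,
    Finset.sum_sub_distrib, h4] at h3'
  rw [zero_sub, neg_eq_zero, Fin.sum_univ_succ] at h3'
  simp only [sub_self, map_zero, LinearMap.zero_apply, smul_zero, zero_add, Fin.val_succ] at h3'
  rw [AlternatingMap.alternatizeUncurryFin_apply, ← neg_eq_zero, ← h3', ← Finset.sum_neg_distrib]
  refine Finset.sum_congr rfl fun b _ => ?_
  have hub : u b.succ = b.removeNth (fun a => v (τ a.succ) - v (τ 0)) := by
    ext1 j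
    simp only [hu, Fin.removeNth, Fin.succ_succAbove_succ, Fin.succ_succAbove_zero]
  rw [hub, pow_succ, mul_neg_one, neg_smul]
  rfl

theorem core {n k m : ℕ} (v : Fin (n + 1) → (Fin n → ℝ))
    (e : Module.Basis (Fin n) ℝ (Fin n → ℝ)) (he : ∀ i, e i = v i.succ - v 0)
    (W : (Fin n → ℝ) [⋀^Fin k]→ₗ[ℝ] MvPolynomial (Fin n) ℝ)
    (hdeg : ∀ u, (W u).totalDegree ≤ m + 1)
    (hK : ∀ u a, ∑ l, X l * homogeneousComponent (m + 1) (W (Function.update u a (Pi.single l 1))) = 0)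
    (hint : ∀ σ : Fin (k + 1) → Fin (n + 1), StrictMono σ →
      ∀ α : Fin (n + 1) → ℕ, (∑ i, α i) = m →
        ∫ x in stdSimplexSet k, eval (∑ i, (α i : ℝ) • v i + par (fun j => v (σ j)) x)
          (W fun j => v (σ j.succ) - v (σ 0)) = 0) : W = 0 := by
  have hcons : ∀ {N : ℕ} (ρ : Fin N → Fin n), StrictMono ρ →
      StrictMono (Fin.cons 0 (fun i => (ρ i).succ) : Fin (N + 1) → Fin (n + 1)) := by
    intro N ρ hρ i j
    refine Fin.cases ?_ (fun i => ?_) i <;> refine Fin.cases ?_ (fun j => ?_) j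
    · simp
    · simp
    · simp
    · simp only [Fin.succ_lt_succ_iff, Fin.cons_succ]
      exact fun h => hρ h
  have hH : (homogeneousComponent (m + 1)).compAlternatingMap W = 0 := by
    refine cartan (m := m) _ (fun u => homogeneousComponent_isHomogeneous _ _) hK ?_
    refine ext_mono e _ fun ρ hρ => ?_
    have := step_d v e he W hdeg hint _ (hcons ρ hρ)
    simpa [he] using this
  have hdeg' : ∀ u, (W u).totalDegree ≤ m := by
    intro u
    refine totalDegree_le_of_hc _ fun j hj => ?_
    obtain rfl | h := eq_or_ne j (m + 1)
    · exact congrArg (fun B => B u) hH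
    · exact homogeneousComponent_eq_zero _ _ (by have := hdeg u; omega)
  refine ext_mono e _ fun ρ hρ => ?_
  set σ : Fin (k + 1) → Fin (n + 1) := Fin.cons 0 (fun i => (ρ i).succ) with hσ
  have hu : (fun i => e (ρ i)) = fun j => v (σ j.succ) - v (σ 0) := by
    ext1 i; simp [he, hσ]
  rw [hu]
  set f := W fun j => v (σ j.succ) - v (σ 0) with hf
  obtain ⟨rem, h1, h2⟩ := avg (fun j => v (σ j)) f f.totalDegree le_rfl
  have hG0 : volS k • f + (volS k / (k + 1)) • DL n (∑ j, v (σ j)) f + rem = 0 := by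
    refine lattice_zero' m v e he _ ?_ ?_
    · refine totalDegree_le_of_hc _ fun j hj => ?_
      have hfm : f.totalDegree ≤ m := hdeg' _
      rw [map_add, map_add, map_smul, map_smul, hc_DL, h2 j (by omega),
        homogeneousComponent_eq_zero _ _ (by omega), homogeneousComponent_eq_zero _ _ (by omega)]
      simp
    · intro α hα
      rw [← h1, hint σ (hcons ρ hρ) α hα]
  have h3 := congrArg (homogeneousComponent f.totalDegree) hG0
  rw [map_add, map_add, map_smul, map_smul, hc_DL, h2 _ (by omega),
    homogeneousComponent_eq_zero (f.totalDegree + 1) f (by omega)] at h3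
  simp only [map_zero, smul_zero, add_zero] at h3
  have h4 := (smul_eq_zero.1 h3).resolve_left (volS_pos k).ne'
  by_contra hne
  obtain ⟨t, ht, htd⟩ := Finset.exists_mem_eq_sup f.support (support_nonempty.2 hne)
    (fun s => s.sum fun _ e => e)
  have h5 := congrArg (coeff t) h4
  rw [coeff_homogeneousComponent, if_pos (by exact htd.symm), coeff_zero] at h5
  exact mem_support_iff.1 ht h5

end HelperSection

/-- (Determination by redundant weights.) A form `ω ∈ P_r^- Λ^k(T)` whose
weights on all small simplices `s_{(α,σ)}` of the redundant set `X_r^k(T)` vanish is zero. -/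
theorem prMinus_determined_by_redundant_weights {n k r : ℕ}
    (hn : 1 ≤ n) (hk : k ≤ n) (hr : 1 ≤ r)
    (v : Fin (n + 1) → (Fin n → ℝ)) (hv : AffineIndependent ℝ v)
    (lam : Fin (n + 1) → ((Fin n → ℝ) →ᵃ[ℝ] ℝ))
    (hlam : ∀ i j, lam i (v j) = if i = j then 1 else 0)
    (ω : Form n k) (hω : ω ∈ PrMinus n k r lam)
    (hint : ∀ σ : Fin (k + 1) → Fin (n + 1), StrictMono σ →
      ∀ α : Fin (n + 1) → ℕ, (∑ i, α i) = r - 1 →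
        simpIntegral ω (smallSimplex v r σ α) = 0) :
    ω = 0 := by
  obtain ⟨m, rfl⟩ : ∃ m, r = m + 1 := ⟨r - 1, by omega⟩
  obtain ⟨W, hW, hdeg, hK⟩ := rep_of_mem lam ω hω
  set v' : Fin (n + 1) → (Fin n → ℝ) := fun i => ((m + 1 : ℕ) : ℝ)⁻¹ • v i with hv'
  have hr0 : ((m + 1 : ℕ) : ℝ)⁻¹ ≠ 0 := by positivity
  have hli : LinearIndependent ℝ (fun i : Fin n => v' i.succ - v' 0) := by
    rw [Fintype.linearIndependent_iff]
    intro g hg i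
    have h1 := congrArg (lam i.succ).linear hg
    have h2 : ∀ j : Fin n, (lam i.succ).linear (v' j.succ - v' 0) =
        ((m + 1 : ℕ) : ℝ)⁻¹ * if i = j then 1 else 0 := by
      intro j
      have h3 := (lam i.succ).linearMap_vsub (v j.succ) (v 0)
      rw [hlam, hlam] at h3
      simp only [vsub_eq_sub] at h3
      simp only [hv', ← smul_sub, map_smul, h3]
      simp
    simp only [map_sum, map_smul, h2, map_zero, smul_eq_mul] at h1
    simp only [mul_ite, mul_one, mul_zero, Finset.sum_ite_eq, Finset.mem_univ, if_true] at h1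
    exact (mul_eq_zero.1 h1).resolve_right hr0
  haveI : Nonempty (Fin n) := ⟨⟨0, hn⟩⟩
  obtain ⟨e, he⟩ : ∃ e : Module.Basis (Fin n) ℝ (Fin n → ℝ), ∀ i, e i = v' i.succ - v' 0 :=
    ⟨basisOfLinearIndependentOfCardEqFinrank hli (by simp), fun i => by
      rw [coe_basisOfLinearIndependentOfCardEqFinrank]⟩
  have hW0 : W = 0 := by
    refine core v' e he W hdeg hK fun σ hσ α hα => ?_
    rw [← hint σ hσ α (by simpa using hα), simpIntegral]
    have hs : ∀ j, smallSimplex v (m + 1) σ α j = v' (σ j) + ∑ i, (α i : ℝ) • v' i := by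
      intro j
      simp only [smallSimplex, hv', smul_add, Finset.smul_sum]
      congr 1
      exact Finset.sum_congr rfl fun i _ => smul_comm _ _ _
    simp only [hW, hs, add_sub_add_right_eq_sub]
    congr 1
    ext x
    rw [par]
    congr 2
    abel
  funext x u
  rw [hW, hW0]
  simp
end
end
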